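/- Let (X,d) be a compact metric space and F = (f_n)_{n≥1} a sequence of homeomorphisms of X such that the non-autonomous system (X,F) is chain transitive and converges uniformly to a continuous map f : X → X. Then the periodic-pseudo-entropy of F is at most the classical topological entropy of f: H_p(F) ≤ h(f). -/

import Mathlib

open Filter Topology Metric

/-- `orbitMap f n = f (n-1) ∘ ⋯ ∘ f 0`, i.e. the time-`n` map `F_n`. -/
def orbitMap {X : Type*} (f : ℕ → X → X) : ℕ → X → X
  | 0 => id
  | n + 1 => f n ∘ orbitMap f n

/-- Maximal cardinality of an `(n, F, ε)`-separated subset of `X`. -/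
noncomputable def sepCard {X : Type*} [MetricSpace X] (f : ℕ → X → X) (n : ℕ) (ε : ℝ) : ℕ :=
  sSup {k | ∃ E : Finset X,
    (∀ x ∈ E, ∀ y ∈ E, x ≠ y → ∃ j < n, ε < dist (orbitMap f j x) (orbitMap f j y)) ∧
    E.card = k}

/-- Topological entropy `h(F)` of the NDS `F`.  For a constant sequence
`f_n = g` this is the classical Bowen topological entropy of `g`. -/
noncomputable def ndsEntropy {X : Type*} [MetricSpace X] (f : ℕ → X → X) : ℝ :=
  ⨆ ε : {e : ℝ // 0 < e}, atTop.limsup fun n => Real.log (sepCard f n ε) / n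

/-- An `(α, F)`-chain of length `k` from `x` to `y`. -/
def IsChainFromTo {X : Type*} [MetricSpace X] (f : ℕ → X → X) (α : ℝ) (k : ℕ)
    (x y : X) : Prop :=
  ∃ c : ℕ → X, c 0 = x ∧ c k = y ∧ ∀ i < k, dist (f i (c i)) (c (i + 1)) < α

/-- The NDS `(X, F)` is chain transitive. -/
def ChainTransitive {X : Type*} [MetricSpace X] (f : ℕ → X → X) : Prop :=
  ∀ α > (0 : ℝ), ∀ x y : X,
    (∃ k, IsChainFromTo f α k x y) ∧ (∃ k, IsChainFromTo f α k y x)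

/-- A periodic `(α, F)`-pseudo-orbit of period `n`. -/
def IsPerPseudoOrbit {X : Type*} [MetricSpace X] (f : ℕ → X → X) (α : ℝ) (n : ℕ)
    (x : ℕ → X) : Prop :=
  (∀ i, i + 1 < n → dist (f i (x i)) (x (i + 1)) < α) ∧
  dist (f (n - 1) (x (n - 1))) (x 0) < α

/-- `p_n(ε, α, F)`: maximal cardinality of an `(n, ε)`-separated set of periodic
`(α, F)`-pseudo-orbits of period `n`. -/
noncomputable def perSepCard {X : Type*} [MetricSpace X] (f : ℕ → X → X)
    (n : ℕ) (ε α : ℝ) : ℕ :=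
  sSup {k | ∃ S : Finset (ℕ → X), (∀ x ∈ S, IsPerPseudoOrbit f α n x) ∧
    (∀ x ∈ S, ∀ y ∈ S, x ≠ y → ∃ i < n, ε < dist (x i) (y i)) ∧
    S.card = k}

/-- The periodic-pseudo-entropy `H_p(F)`. -/
noncomputable def perPseudoEntropy {X : Type*} [MetricSpace X] (f : ℕ → X → X) : ℝ :=
  ⨆ ε : {e : ℝ // 0 < e}, ⨅ α : {a : ℝ // 0 < a},
    atTop.limsup fun n => Real.log (perSepCard f n ε α) / n

lemma orbitMap_surjective {X : Type*} {f : ℕ → X → X} (hf : ∀ n, Function.Surjective (f n)) (n : ℕ) :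
    Function.Surjective (orbitMap f n) := by
  induction n with
  | zero => exact Function.surjective_id
  | succ n ih => exact (hf n).comp ih

section NonAutonomous

variable {X : Type*} [MetricSpace X] [CompactSpace X]

/-- In finite time, pseudo-orbits with small errors stay close to genuine orbits. -/
lemma exists_shadow (f : ℕ → X → X) (hf : ∀ n, Continuous (f n)) (M : ℕ) :
    ∀ η > (0 : ℝ), ∃ δ > (0 : ℝ), ∀ c : ℕ → X, ∀ r ≤ M,
      (∀ i < r, dist (f i (c i)) (c (i + 1)) < δ) → dist (c r) (orbitMap f r (c 0)) < η := by
  induction M with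
  | zero =>
    intro η hη
    refine ⟨1, one_pos, fun c r hr _ => ?_⟩
    obtain rfl : r = 0 := by omega
    simpa [orbitMap] using hη
  | succ M ih =>
    intro η hη
    have huc := CompactSpace.uniformContinuous_of_continuous (hf M)
    obtain ⟨δ₁, hδ₁, h₁⟩ := Metric.uniformContinuous_iff.1 huc (η / 2) (by positivity)
    obtain ⟨δ₂, hδ₂, h₂⟩ := ih δ₁ hδ₁
    obtain ⟨δ₃, hδ₃, h₃⟩ := ih η hη
    refine ⟨min (min δ₂ δ₃) (η / 2), by positivity, fun c r hr hc => ?_⟩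
    rcases Nat.lt_or_ge M r with h | h
    · obtain rfl : r = M + 1 := by omega
      have hM := h₂ c M le_rfl fun i hi =>
        (hc i (by omega)).trans_le ((min_le_left _ _).trans (min_le_left _ _))
      have hstep := (hc M (by omega)).trans_le (min_le_right _ _)
      have := h₁ hM
      rw [dist_comm] at hstep
      calc dist (c (M + 1)) (orbitMap f (M + 1) (c 0))
          ≤ dist (c (M + 1)) (f M (c M)) + dist (f M (c M)) (f M (orbitMap f M (c 0))) :=
            dist_triangle _ _ _
        _ < η := by linarith
    · exact h₃ c r h fun i hi =>
        (hc i hi).trans_le ((min_le_left _ _).trans (min_le_right _ _))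

lemma exists_finite_net {δ : ℝ} (hδ : 0 < δ) :
    ∃ Z : Finset X, ∃ c : X → Z, ∀ x : X, dist x (c x) < δ := by
  obtain ⟨t, -, ht, hcov⟩ := finite_cover_balls_of_compact (isCompact_univ (X := X)) hδ
  have h : ∀ x : X, ∃ z : ht.toFinset, dist x z < δ := by
    intro x
    obtain ⟨z, hz, hxz⟩ := Set.mem_iUnion₂.1 (hcov (Set.mem_univ x))
    exact ⟨⟨z, by simpa using hz⟩, hxz⟩
  choose c hc using h
  exact ⟨ht.toFinset, c, hc⟩

/-- An open set which eventually absorbs all pseudo-orbits has finite complement. -/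
lemma ChainTransitive.compl_finite {f : ℕ → X → X} (htrans : ChainTransitive f)
    (hf : ∀ n, Continuous (f n)) {V : Set X} (hV : IsOpen V) {N : ℕ} {δ : ℝ} (hδ : 0 < δ)
    (habs : ∀ n ≥ N, ∀ z ∈ V, ∀ w, dist (f n z) w < δ → w ∈ V)
    {x : X} (hx : orbitMap f N x ∈ V) : Vᶜ.Finite := by
  let T : Set X := (fun k => orbitMap f k x) '' Set.Iio N
  have hTfin : T.Finite := (Set.finite_Iio N).image _
  refine hTfin.subset fun y hy => ?_
  by_contra hyT
  obtain ⟨ε₁, hε₁, h₁⟩ := Metric.isOpen_iff.1 hV _ hx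
  obtain ⟨ε₂, hε₂, h₂⟩ := Metric.isOpen_iff.1 hTfin.isClosed.isOpen_compl y hyT
  obtain ⟨δ', hδ', hsh⟩ := exists_shadow f hf N (min ε₁ ε₂) (by positivity)
  obtain ⟨k, c, hc0, hck, hc⟩ := (htrans (min δ δ') (by positivity) x y).1
  rcases Nat.lt_or_ge k N with hk | hk
  · have := hsh c k hk.le fun i hi => (hc i hi).trans_le (min_le_right _ _)
    rw [hck, hc0, dist_comm] at this
    exact h₂ (this.trans_le (min_le_right _ _)) ⟨k, hk, rfl⟩
  · have := hsh c N le_rfl fun i hi => (hc i (hi.trans_le hk)).trans_le (min_le_right _ _)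
    rw [hc0] at this
    have hN : c N ∈ V := h₁ (this.trans_le (min_le_left _ _))
    have hstay : ∀ j, N + j ≤ k → c (N + j) ∈ V := by
      intro j
      induction j with
      | zero => intro _; exact hN
      | succ j ih =>
        intro hj
        exact habs (N + j) (by omega) _ (ih (by omega)) _
          ((hc (N + j) (by omega)).trans_le (min_le_left _ _))
    have := hstay (k - N) (by omega)
    rw [Nat.add_sub_cancel' hk, hck] at this
    exact hy this

/-- On an infinite space, the limit of a chain transitive system is chain transitive. -/
lemma ChainTransitive.limit [Infinite X] {f : ℕ → X ≃ₜ X}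
    (htrans : ChainTransitive (fun n => (f n : X → X))) {g : X → X}
    (hconv : TendstoUniformly (fun n => (f n : X → X)) g atTop)
    {α : ℝ} (hα : 0 < α) (x y : X) :
    ∃ k, 1 ≤ k ∧ IsChainFromTo (fun _ => g) α k x y := by
  by_contra hxy
  let U : Set X := {z | ∃ k, 1 ≤ k ∧ IsChainFromTo (fun _ => g) α k x z}
  have hcont : ∀ n, Continuous (fun z => f n z) := fun n => (f n).continuous
  have hstep : ∀ z ∈ U, ∀ w, dist (g z) w < α → w ∈ U := by
    rintro z ⟨k, hk, c, hc0, hck, hc⟩ w hw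
    refine ⟨k + 1, by omega, fun i => if i ≤ k then c i else w, by simpa using hc0, by simp, ?_⟩
    intro i hi
    rcases Nat.lt_or_ge i k with h | h
    · simpa [h.le, Nat.succ_le_of_lt h] using hc i h
    · obtain rfl : i = k := by omega
      simpa [hck] using hw
  have hgx : ∀ w, dist (g x) w < α → w ∈ U := by
    intro w hw
    refine ⟨1, le_rfl, fun i => if i = 0 then x else w, by simp, by simp, ?_⟩
    intro i hi
    obtain rfl : i = 0 := by omega
    simpa using hw
  have hUopen : IsOpen U := by
    refine Metric.isOpen_iff.2 fun z hz => ?_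
    obtain ⟨k, hk, c, hc0, hck, hc⟩ := hz
    have hlast := hc (k - 1) (by omega)
    rw [Nat.sub_add_cancel hk, hck] at hlast
    refine ⟨α - dist (g (c (k - 1))) z, by linarith, fun w hw => ?_⟩
    have hw' : dist (g (c (k - 1))) w < α := by
      have := dist_triangle (g (c (k - 1))) z w
      rw [Metric.mem_ball, dist_comm] at hw
      linarith
    rcases Nat.lt_or_ge 1 k with h | h
    · exact hstep _ ⟨k - 1, by omega, c, hc0, rfl, fun i hi => hc i (by omega)⟩ w hw'
    · obtain rfl : k = 1 := by omega
      simp only [Nat.sub_self, hc0] at hw'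
      exact hgx w hw'
  obtain ⟨N, hN⟩ := eventually_atTop.1
    (Metric.tendstoUniformly_iff.1 hconv (α / 2) (by positivity))
  have habs : ∀ n ≥ N, ∀ z ∈ U, ∀ w, dist (f n z) w < α / 2 → w ∈ U := by
    intro n hn z hz w hw
    refine hstep z hz w ?_
    have := dist_triangle (g z) (f n z) w
    have := hN n hn z
    linarith
  have hsurj := orbitMap_surjective (f := fun n => (f n : X → X)) (fun n => (f n).surjective) N
  have hEfin : Uᶜ.Finite := by
    obtain ⟨z, hz⟩ := hsurj (g x)
    refine htrans.compl_finite hcont hUopen (half_pos hα) habs (x := z) ?_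
    rw [hz]
    exact hgx _ (by simpa using hα)
  have hfE : ∀ n ≥ N, ∀ z ∈ Uᶜ, f n z ∈ Uᶜ := by
    intro n hn
    have hmaps : Set.MapsTo (f n).symm Uᶜ Uᶜ := by
      intro e he hmem
      exact he (habs n hn _ hmem e (by simpa using hα))
    have hbij := (hEfin.injOn_iff_bijOn_of_mapsTo hmaps).1 (f n).symm.injective.injOn
    intro z hz
    obtain ⟨e, he, rfl⟩ := hbij.surjOn hz
    simpa using he
  have hball : ∀ n ≥ N, ∀ z ∈ Uᶜ, ∀ w, dist (f n z) w < α / 2 → w ∈ Uᶜ := by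
    intro n hn z hz w hw hwU
    obtain ⟨v, rfl⟩ := (f n).surjective w
    have hv : v ∈ U := by
      by_contra hv
      exact hfE n hn v hv hwU
    rw [dist_comm] at hw
    exact hfE n hn z hz (habs n hn v hv _ hw)
  have hEopen : IsOpen Uᶜ := by
    refine Metric.isOpen_iff.2 fun e he => ⟨α / 2, by positivity, fun w hw hwU => he ?_⟩
    obtain ⟨v, rfl⟩ := (f N).surjective w
    have hv : v ∈ U := by
      by_contra hv
      exact hfE N le_rfl v hv hwU
    exact habs N le_rfl v hv e (by rwa [Metric.mem_ball] at hw)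
  have hUfin : U.Finite := by
    obtain ⟨z, hz⟩ := hsurj y
    rw [← compl_compl U]
    refine htrans.compl_finite hcont hEopen (half_pos hα) hball (x := z) ?_
    rw [hz]
    exact hxy
  exact Set.infinite_univ (by simpa using hUfin.union hEfin)

end NonAutonomous

section Growth

/-- The cardinality of an exponentially growing sequence has growth rate at most the exponent. -/
lemma limsup_log_div_le {s : ℕ → ℕ} {β K : ℝ}
    (h : ∀ᶠ n : ℕ in atTop, Real.log (s n) ≤ β * n + K) :
    atTop.limsup (fun n : ℕ => Real.log (s n) / n) ≤ β := by
  have hlim : Tendsto (fun n : ℕ => β + K / n) atTop (𝓝 β) := by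
    simpa using (tendsto_const_div_atTop_nhds_zero_nat K).const_add β
  rw [← hlim.limsup_eq]
  refine limsup_le_limsup ?_ ?_ hlim.isBoundedUnder_le
  · filter_upwards [h, eventually_gt_atTop 0] with n hn hpos
    have hpos' : (0 : ℝ) < n := by exact_mod_cast hpos
    rw [div_le_iff₀ hpos', add_mul, div_mul_cancel₀ _ hpos'.ne']
    exact hn
  · exact (isBoundedUnder_of ⟨0, fun _ => div_nonneg (Real.log_natCast_nonneg _)
      (Nat.cast_nonneg _)⟩ : IsBoundedUnder (· ≥ ·) atTop _).isCoboundedUnder_le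

lemma log_natCast_le_log {a b : ℕ} (h : a ≤ b) : Real.log a ≤ Real.log b := by
  rcases Nat.eq_zero_or_pos a with rfl | ha
  · simpa using Real.log_natCast_nonneg b
  · exact Real.log_le_log (by exact_mod_cast ha) (by exact_mod_cast h)

lemma isBoundedUnder_log_div {s : ℕ → ℕ} {C : ℕ} (h : ∀ n, s n ≤ C ^ n) :
    IsBoundedUnder (· ≤ ·) atTop (fun n : ℕ => Real.log (s n) / n) := by
  refine isBoundedUnder_of ⟨Real.log C, fun n => ?_⟩
  have := log_natCast_le_log (h n)
  rw [Nat.cast_pow, Real.log_pow] at this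
  exact div_le_of_le_mul₀ (Nat.cast_nonneg _) (Real.log_natCast_nonneg _) (by linarith)

lemma limsup_log_div_nonneg {s : ℕ → ℕ} {C : ℕ} (h : ∀ n, s n ≤ C ^ n) :
    0 ≤ atTop.limsup (fun n : ℕ => Real.log (s n) / n) :=
  le_limsup_of_frequently_le (Frequently.of_forall fun _ =>
    div_nonneg (Real.log_natCast_nonneg _) (Nat.cast_nonneg _)) (isBoundedUnder_log_div h)

end Growth

section Counting

variable {X : Type*} [MetricSpace X]

lemma card_le_of_code {A T : Type*} [Fintype T] {S : Finset A} {D : A → A → Prop}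
    (hsep : ∀ x ∈ S, ∀ y ∈ S, x ≠ y → D x y) (φ : A → T)
    (hφ : ∀ x ∈ S, ∀ y ∈ S, φ x = φ y → ¬ D x y) : S.card ≤ Fintype.card T := by
  rw [← Finset.card_univ]
  refine Finset.card_le_card_of_injOn φ (fun _ _ => Finset.mem_coe.2 (Finset.mem_univ _)) ?_
  intro x hx y hy hxy
  by_contra hne
  exact hφ x hx y hy hxy (hsep x hx y hy hne)

lemma sep_card_le {f : ℕ → X → X} {n : ℕ} {ε : ℝ} {Z : Finset X} {c : X → Z}
    (hc : ∀ x : X, dist x (c x) < ε / 2) {E : Finset X}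
    (hE : ∀ x ∈ E, ∀ y ∈ E, x ≠ y → ∃ j < n, ε < dist (orbitMap f j x) (orbitMap f j y)) :
    E.card ≤ Z.card ^ n := by
  refine (card_le_of_code hE (fun x (j : Fin n) => c (orbitMap f j x)) ?_).trans_eq (by simp)
  rintro x - y - hxy ⟨j, hj, hlt⟩
  have h := congrFun hxy ⟨j, hj⟩
  simp only at h
  have h₁ := hc (orbitMap f j x)
  have h₂ := hc (orbitMap f j y)
  rw [h] at h₁
  have := dist_triangle_right (orbitMap f j x) (orbitMap f j y) (c (orbitMap f j y))
  linarith

lemma perSep_card_le {n : ℕ} {ε : ℝ} {Z : Finset X} {c : X → Z}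
    (hc : ∀ x : X, dist x (c x) < ε / 2) {S : Finset (ℕ → X)}
    (hS : ∀ x ∈ S, ∀ y ∈ S, x ≠ y → ∃ i < n, ε < dist (x i) (y i)) :
    S.card ≤ Z.card ^ n := by
  refine (card_le_of_code hS (fun x (j : Fin n) => c (x j)) ?_).trans_eq (by simp)
  rintro x - y - hxy ⟨j, hj, hlt⟩
  have h := congrFun hxy ⟨j, hj⟩
  simp only at h
  have h₁ := hc (x j)
  have h₂ := hc (y j)
  rw [h] at h₁
  have := dist_triangle_right (x j) (y j) (c (y j))
  linarith

variable [CompactSpace X]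

lemma bddAbove_sepCard (f : ℕ → X → X) (n : ℕ) {ε : ℝ} (hε : 0 < ε) :
    BddAbove {k | ∃ E : Finset X,
      (∀ x ∈ E, ∀ y ∈ E, x ≠ y → ∃ j < n, ε < dist (orbitMap f j x) (orbitMap f j y)) ∧
      E.card = k} := by
  obtain ⟨Z, c, hc⟩ := exists_finite_net (X := X) (half_pos hε)
  exact ⟨Z.card ^ n, by rintro k ⟨E, hE, rfl⟩; exact sep_card_le hc hE⟩

lemma bddAbove_perSepCard (f : ℕ → X → X) (n : ℕ) {ε : ℝ} (hε : 0 < ε) (α : ℝ) :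
    BddAbove {k | ∃ S : Finset (ℕ → X), (∀ x ∈ S, IsPerPseudoOrbit f α n x) ∧
      (∀ x ∈ S, ∀ y ∈ S, x ≠ y → ∃ i < n, ε < dist (x i) (y i)) ∧ S.card = k} := by
  obtain ⟨Z, c, hc⟩ := exists_finite_net (X := X) (half_pos hε)
  exact ⟨Z.card ^ n, by rintro k ⟨S, -, hS, rfl⟩; exact perSep_card_le hc hS⟩

lemma exists_sepCard_le_pow {ε : ℝ} (hε : 0 < ε) :
    ∃ C : ℕ, ∀ (f : ℕ → X → X) (n : ℕ), sepCard f n ε ≤ C ^ n := by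
  obtain ⟨Z, c, hc⟩ := exists_finite_net (X := X) (half_pos hε)
  refine ⟨Z.card, fun f n => csSup_le ⟨0, ∅, by simp⟩ ?_⟩
  rintro k ⟨E, hE, rfl⟩
  exact sep_card_le hc hE

lemma exists_perSepCard_le_pow {ε : ℝ} (hε : 0 < ε) :
    ∃ C : ℕ, ∀ (f : ℕ → X → X) (α : ℝ) (n : ℕ), perSepCard f n ε α ≤ C ^ n := by
  obtain ⟨Z, c, hc⟩ := exists_finite_net (X := X) (half_pos hε)
  refine ⟨Z.card, fun f α n => csSup_le ⟨0, ∅, by simp⟩ ?_⟩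
  rintro k ⟨S, -, hS, rfl⟩
  exact perSep_card_le hc hS

lemma exists_card_eq_sepCard (f : ℕ → X → X) (n : ℕ) {ε : ℝ} (hε : 0 < ε) :
    ∃ E : Finset X, (∀ x ∈ E, ∀ y ∈ E, x ≠ y →
      ∃ j < n, ε < dist (orbitMap f j x) (orbitMap f j y)) ∧ E.card = sepCard f n ε :=
  Nat.sSup_mem (s := {k | ∃ E : Finset X, (∀ x ∈ E, ∀ y ∈ E, x ≠ y →
      ∃ j < n, ε < dist (orbitMap f j x) (orbitMap f j y)) ∧ E.card = k})
    ⟨0, ∅, by simp⟩ (bddAbove_sepCard f n hε)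

/-- A maximal separated set is spanning. -/
lemma exists_spanning_card_eq_sepCard (f : ℕ → X → X) (n : ℕ) {ε : ℝ} (hε : 0 < ε) :
    ∃ E : Finset X, E.card = sepCard f n ε ∧ ∃ c : X → E,
      ∀ x, ∀ j < n, dist (orbitMap f j x) (orbitMap f j (c x)) ≤ ε := by
  classical
  obtain ⟨E, hE, hcard⟩ := exists_card_eq_sepCard f n hε
  have h : ∀ x, ∃ e : E, ∀ j < n, dist (orbitMap f j x) (orbitMap f j e) ≤ ε := by
    intro x
    by_contra! hx
    have hxE : x ∉ E := by
      intro hmem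
      obtain ⟨j, -, hj⟩ := hx ⟨x, hmem⟩
      simp only [dist_self] at hj
      linarith
    have hle : (insert x E).card ≤ sepCard f n ε := by
      refine le_csSup (bddAbove_sepCard f n hε) ⟨insert x E, ?_, rfl⟩
      intro a ha b hb hab
      rcases Finset.mem_insert.1 ha with rfl | ha' <;> rcases Finset.mem_insert.1 hb with rfl | hb'
      · exact absurd rfl hab
      · exact hx ⟨b, hb'⟩
      · obtain ⟨j, hj, hlt⟩ := hx ⟨a, ha'⟩
        exact ⟨j, hj, by rwa [dist_comm]⟩
      · exact hE a ha' b hb' hab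
    rw [Finset.card_insert_of_notMem hxE] at hle
    omega
  choose c hc using h
  exact ⟨E, hcard, c, hc⟩

end Counting

section Comparison

variable {X : Type*} [MetricSpace X] [CompactSpace X]

/-- Periodic pseudo-orbits with small errors are coded by blocks of orbits of the limit map. -/
lemma exists_perSepCard_le {f : ℕ → X → X} {g : X → X} (hg : Continuous g)
    (hconv : TendstoUniformly f g atTop) {ε : ℝ} (hε : 0 < ε) {M : ℕ} (hM : 0 < M) :
    ∃ α > (0 : ℝ), ∃ K : ℕ, ∀ n,
      perSepCard f n ε α ≤ K * sepCard (fun _ => g) M (ε / 4) ^ (n / M + 1) := by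
  obtain ⟨Z, c, hc⟩ := exists_finite_net (X := X) (half_pos hε)
  obtain ⟨E, hcard, e, he⟩ :=
    exists_spanning_card_eq_sepCard (fun _ => g) M (by positivity : 0 < ε / 4)
  obtain ⟨δ, hδ, hsh⟩ := exists_shadow (fun _ => g) (fun _ => hg) M (ε / 4) (by positivity)
  obtain ⟨N, hN⟩ := eventually_atTop.1
    (Metric.tendstoUniformly_iff.1 hconv (δ / 2) (by positivity))
  refine ⟨δ / 2, by positivity, Z.card ^ N, fun n => csSup_le ⟨0, ∅, by simp⟩ ?_⟩
  rintro k ⟨S, hS, hsep, rfl⟩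
  refine (card_le_of_code hsep (fun x => ((fun i : Fin N => c (x i)),
    fun q : Fin (n / M + 1) => e (x (N + M * q)))) ?_).trans_eq (by simp [hcard])
  rintro x hx y hy hxy ⟨i, hi, hlt⟩
  rw [Prod.mk.injEq] at hxy
  rcases Nat.lt_or_ge i N with hiN | hiN
  · have h := congrFun hxy.1 ⟨i, hiN⟩
    simp only at h
    have h₁ := hc (x i)
    have h₂ := hc (y i)
    rw [h] at h₁
    have := dist_triangle_right (x i) (y i) (c (y i))
    linarith
  · set q := (i - N) / M
    set r := (i - N) % M
    have hdiv : M * q + r = i - N := Nat.div_add_mod _ _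
    have hrM : r < M := Nat.mod_lt _ hM
    have hqn : q < n / M + 1 := Nat.lt_succ_of_le (Nat.div_le_div_right (by omega))
    have hi' : i = N + M * q + r := by omega
    have hblock : ∀ z ∈ S, dist (z i) (orbitMap (fun _ => g) r (z (N + M * q))) < ε / 4 := by
      intro z hz
      have := hsh (fun j => z (N + M * q + j)) r hrM.le fun j hj => ?_
      · simpa [hi'] using this
      · have h₁ := (hS z hz).1 (N + M * q + j) (by omega)
        have h₂ := hN (N + M * q + j) (by omega) (z (N + M * q + j))
        have := dist_triangle (g (z (N + M * q + j))) (f (N + M * q + j) (z (N + M * q + j)))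
          (z (N + M * q + j + 1))
        show dist (g (z (N + M * q + j))) (z (N + M * q + j + 1)) < δ
        linarith
    have h := congrFun hxy.2 ⟨q, hqn⟩
    simp only at h
    have hx₁ := hblock x hx
    have hy₁ := hblock y hy
    have hx₂ := he (x (N + M * q)) r hrM
    have hy₂ := he (y (N + M * q)) r hrM
    rw [h] at hx₂
    set p := orbitMap (fun _ => g) r (e (y (N + M * q)))
    have h₁ := dist_triangle_right (x i) (y i) p
    have h₂ := dist_triangle (x i) (orbitMap (fun _ => g) r (x (N + M * q))) p
    have h₃ := dist_triangle (y i) (orbitMap (fun _ => g) r (y (N + M * q))) p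
    linarith

lemma iInf_limsup_le_limsup {f : ℕ → X → X} {g : X → X} (hg : Continuous g)
    (hconv : TendstoUniformly f g atTop) {ε : ℝ} (hε : 0 < ε) :
    (⨅ α : {a : ℝ // 0 < a}, atTop.limsup fun n => Real.log (perSepCard f n ε α) / n) ≤
      atTop.limsup fun n => Real.log (sepCard (fun _ => g) n (ε / 4)) / n := by
  obtain ⟨C, hC⟩ := exists_sepCard_le_pow (X := X) (by positivity : 0 < ε / 4)
  obtain ⟨C', hC'⟩ := exists_perSepCard_le_pow (X := X) hε
  refine le_limsup_of_frequently_le ((eventually_gt_atTop 0).mono fun M hM => ?_).frequently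
    (isBoundedUnder_log_div (hC _))
  obtain ⟨α, hα, K, hK⟩ := exists_perSepCard_le hg hconv hε hM
  refine (ciInf_le ⟨0, ?_⟩ (⟨α, hα⟩ : {a : ℝ // 0 < a})).trans ?_
  · rintro _ ⟨α, rfl⟩
    exact limsup_log_div_nonneg (hC' f α)
  set s := sepCard (fun _ => g) M (ε / 4)
  refine limsup_log_div_le (K := Real.log K + Real.log s) (Eventually.of_forall fun n => ?_)
  have hM' : (0 : ℝ) < M := by exact_mod_cast hM
  have hlogs := Real.log_natCast_nonneg s
  have hlogK := Real.log_natCast_nonneg K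
  have hdiv : ((n / M : ℕ) : ℝ) ≤ n / M := Nat.cast_div_le
  have hmain : Real.log (perSepCard f n ε α) ≤
      Real.log K + ((n / M : ℕ) + 1) * Real.log s := by
    refine (log_natCast_le_log (hK n)).trans ?_
    rcases eq_or_ne (K * s ^ (n / M + 1)) 0 with h0 | h0
    · rw [h0, Nat.cast_zero, Real.log_zero]
      positivity
    · have hK0 : (K : ℝ) ≠ 0 := by exact_mod_cast left_ne_zero_of_mul h0
      have hs0 : ((s : ℝ) ^ (n / M + 1)) ≠ 0 := by exact_mod_cast right_ne_zero_of_mul h0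
      rw [Nat.cast_mul, Nat.cast_pow, Real.log_mul hK0 hs0, Real.log_pow]
      push_cast
      rfl
  calc _ ≤ _ := hmain
    _ ≤ Real.log K + ((n / M : ℝ) + 1) * Real.log s := by gcongr
    _ = Real.log s / M * n + (Real.log K + Real.log s) := by ring

end Comparison

section Concatenation

variable {X : Type*}

/-- The sequence which follows `a` before time `k` and a shifted `b` from then on. -/
def concatSeq (k : ℕ) (a b : ℕ → X) (i : ℕ) : X := if i < k then a i else b (i - k)

lemma concatSeq_of_lt {k i : ℕ} {a b : ℕ → X} (h : i < k) : concatSeq k a b i = a i := if_pos h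

lemma concatSeq_add {k i : ℕ} {a b : ℕ → X} : concatSeq k a b (k + i) = b i := by
  simp [concatSeq]

lemma concatSeq_isPseudoOrbit [MetricSpace X] {f : ℕ → X → X} {α : ℝ} {k l : ℕ} {a b : ℕ → X}
    (ha : ∀ i, i + 1 < k → dist (f i (a i)) (a (i + 1)) < α)
    (hab : ∀ i, i + 1 = k → dist (f i (a i)) (b 0) < α)
    (hb : ∀ i, i + 1 < l → dist (f (k + i) (b i)) (b (i + 1)) < α) (i : ℕ) (hi : i + 1 < k + l) :
    dist (f i (concatSeq k a b i)) (concatSeq k a b (i + 1)) < α := by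
  rcases lt_trichotomy (i + 1) k with h | h | h
  · rw [concatSeq_of_lt (by omega), concatSeq_of_lt h]
    exact ha i h
  · have : concatSeq k a b (i + 1) = b 0 := by rw [h]; exact concatSeq_add (i := 0)
    rw [concatSeq_of_lt (by omega), this]
    exact hab i h
  · obtain ⟨j, rfl⟩ : ∃ j, i = k + j := ⟨i - k, by omega⟩
    rw [add_assoc, concatSeq_add, concatSeq_add]
    exact hb j (by omega)

end Concatenation

section LowerBound

variable {X : Type*} [MetricSpace X] [CompactSpace X]

/-- When the limit map is chain transitive, its orbit segments can be closed up, in bounded time,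
to periodic pseudo-orbits of the non-autonomous system. -/
lemma exists_sepCard_le_perSepCard [Nonempty X] {f : ℕ → X → X} {g : X → X}
    (hconv : TendstoUniformly f g atTop)
    (hchain : ∀ α > (0 : ℝ), ∀ x y, ∃ k, 1 ≤ k ∧ IsChainFromTo (fun _ => g) α k x y)
    {ε α : ℝ} (hε : 0 < ε) (hα : 0 < α) :
    ∃ L K : ℕ, 0 < K ∧ ∀ n, 0 < n → ∃ m, n ≤ m ∧ m ≤ n + L ∧
      sepCard (fun _ => g) n ε ≤ K * perSepCard f m ε α := by
  classical
  obtain ⟨x₀⟩ := ‹Nonempty X›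
  obtain ⟨N₀, hN₀⟩ := eventually_atTop.1
    (Metric.tendstoUniformly_iff.1 hconv (α / 2) (by positivity))
  set N := N₀ + 1
  have hN : ∀ n ≥ N, ∀ x y, dist (g x) y < α / 2 → dist (f n x) y < α := by
    intro n hn x y hxy
    have h := hN₀ n (by omega) x
    have := dist_triangle_left (f n x) y (g x)
    linarith
  obtain ⟨Z, c, hc⟩ := exists_finite_net (X := X) (by positivity : 0 < α / 4)
  choose k hk u hu0 huk hu using
    fun z : Z => hchain (α / 4) (by positivity) (orbitMap f N x₀) z
  choose l hl v hv0 hvl hv using fun z : Z => hchain (α / 4) (by positivity) (z : X) x₀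
  refine ⟨N + ∑ z, k z + ∑ z, l z, Fintype.card (Z × Z),
    Fintype.card_pos_iff.2 ⟨(c x₀, c x₀)⟩, fun n hn => ?_⟩
  obtain ⟨E, hE, hcard⟩ := exists_card_eq_sepCard (fun _ => g) n hε
  let code : X → Z × Z := fun e => (c e, c (orbitMap (fun _ => g) n e))
  obtain ⟨⟨z, z'⟩, -, hzz⟩ : ∃ p ∈ (Finset.univ : Finset (Z × Z)),
      E.card ≤ Fintype.card (Z × Z) * (E.filter fun e => code e = p).card := by
    by_contra! hlt
    have hsum := Finset.card_eq_sum_card_fiberwise (f := code) (s := E) (t := Finset.univ)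
      (fun _ _ => Finset.mem_coe.2 (Finset.mem_univ _))
    have hne : (Finset.univ : Finset (Z × Z)).Nonempty := ⟨(c x₀, c x₀), Finset.mem_univ _⟩
    have := Finset.sum_lt_sum_of_nonempty hne hlt
    rw [← Finset.mul_sum, ← hsum, Finset.sum_const, Finset.card_univ, smul_eq_mul] at this
    exact lt_irrefl _ this
  have hkle : k z ≤ ∑ z, k z := Finset.single_le_sum (fun _ _ => Nat.zero_le _) (Finset.mem_univ z)
  have hlle : l z' ≤ ∑ z, l z :=
    Finset.single_le_sum (fun _ _ => Nat.zero_le _) (Finset.mem_univ z')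
  have hkz := hk z
  have hlz := hl z'
  refine ⟨N + (k z + (n + l z')), by omega, by omega, ?_⟩
  rw [← hcard]
  refine hzz.trans (Nat.mul_le_mul_left _ ?_)
  let w : X → ℕ → X := fun e => concatSeq N (fun i => orbitMap f i x₀)
    (concatSeq (k z) (u z) (concatSeq n (fun i => orbitMap (fun _ => g) i e) (v z')))
  have hw : ∀ e, ∀ j < n, w e (N + (k z + j)) = orbitMap (fun _ => g) j e := by
    intro e j hj
    simp only [w]
    rw [concatSeq_add, concatSeq_add, concatSeq_of_lt hj]
  set G := E.filter fun e => code e = (z, z')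
  have hsep : ∀ a ∈ G, ∀ b ∈ G, a ≠ b →
      ∃ i < N + (k z + (n + l z')), ε < dist (w a i) (w b i) := by
    intro a ha b hb hab
    obtain ⟨j, hj, hlt⟩ := hE a (Finset.mem_filter.1 ha).1 b (Finset.mem_filter.1 hb).1 hab
    exact ⟨N + (k z + j), by omega, by rwa [hw a j hj, hw b j hj]⟩
  have hinj : Set.InjOn w G := by
    intro a ha b hb hab
    by_contra hne
    obtain ⟨i, -, hlt⟩ := hsep a ha b hb hne
    rw [hab, dist_self] at hlt
    linarith
  refine le_csSup (bddAbove_perSepCard f _ hε α) ⟨G.image w, ?_, ?_, Finset.card_image_of_injOn hinj⟩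
  · intro x hx
    obtain ⟨e, he, rfl⟩ := Finset.mem_image.1 hx
    have hcode : code e = (z, z') := (Finset.mem_filter.1 he).2
    have hz : c e = z := congrArg Prod.fst hcode
    have hz' : c (orbitMap (fun _ => g) n e) = z' := congrArg Prod.snd hcode
    refine ⟨?_, ?_⟩
    · refine concatSeq_isPseudoOrbit ?_ ?_ ?_
      · intro i _
        simpa [orbitMap] using hα
      · intro i hi
        rw [concatSeq_of_lt (by omega), hu0, ← hi]
        simpa [orbitMap] using hα
      · intro i hi
        refine hN _ (by omega) _ _ ?_
        refine concatSeq_isPseudoOrbit (f := fun _ => g) (l := n + l z') ?_ ?_ ?_ i hi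
        · intro i hi
          have := hu z i (by omega)
          linarith
        · intro i hi
          have h₁ := hu z i (by omega)
          rw [hi, huk] at h₁
          have h₂ := hc e
          rw [hz, dist_comm] at h₂
          rw [concatSeq_of_lt hn]
          have := dist_triangle (g (u z i)) z e
          simp only [orbitMap, id]
          linarith
        · intro i hi
          refine concatSeq_isPseudoOrbit (f := fun _ => g) (l := l z') ?_ ?_ ?_ i hi
          · intro i _
            simpa [orbitMap] using hα
          · intro i hi
            have h₂ := hc (orbitMap (fun _ => g) n e)
            rw [hz', ← hi] at h₂
            rw [hv0]
            simp only [orbitMap, Function.comp] at h₂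
            linarith
          · intro i hi
            have := hv z' i (by omega)
            linarith
    · have hlast : N + (k z + (n + l z')) - 1 = N + (k z + (n + (l z' - 1))) := by omega
      have h0 : w e 0 = x₀ := concatSeq_of_lt (by omega)
      rw [h0, hlast]
      simp only [w]
      rw [concatSeq_add, concatSeq_add, concatSeq_add]
      refine hN _ (by omega) _ _ ?_
      have := hv z' (l z' - 1) (by omega)
      rw [Nat.sub_add_cancel hlz, hvl] at this
      linarith
  · intro x hx y hy hxy
    obtain ⟨a, ha, rfl⟩ := Finset.mem_image.1 hx
    obtain ⟨b, hb, rfl⟩ := Finset.mem_image.1 hy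
    exact hsep a ha b hb fun h => hxy (h ▸ rfl)

lemma limsup_le_iInf_limsup [Nonempty X] {f : ℕ → X → X} {g : X → X}
    (hconv : TendstoUniformly f g atTop)
    (hchain : ∀ α > (0 : ℝ), ∀ x y, ∃ k, 1 ≤ k ∧ IsChainFromTo (fun _ => g) α k x y)
    {ε : ℝ} (hε : 0 < ε) :
    (atTop.limsup fun n => Real.log (sepCard (fun _ => g) n ε) / n) ≤
      ⨅ α : {a : ℝ // 0 < a}, atTop.limsup fun n => Real.log (perSepCard f n ε α) / n := by
  obtain ⟨C, hC⟩ := exists_perSepCard_le_pow (X := X) hε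
  have : Nonempty {a : ℝ // 0 < a} := ⟨⟨1, one_pos⟩⟩
  refine le_ciInf fun ⟨α, hα⟩ => ?_
  refine le_of_forall_gt_imp_ge_of_dense fun β hβ => ?_
  have hβ0 : 0 < β := (limsup_log_div_nonneg (hC f α)).trans_lt hβ
  obtain ⟨n₀, hn₀⟩ := eventually_atTop.1
    (eventually_lt_of_limsup_lt hβ (isBoundedUnder_log_div (hC f α)))
  obtain ⟨L, K, hK, hLK⟩ := exists_sepCard_le_perSepCard hconv hchain hε hα
  refine limsup_log_div_le (K := β * L + Real.log K) ?_
  filter_upwards [eventually_ge_atTop n₀, eventually_gt_atTop 0] with n hn hpos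
  obtain ⟨m, hnm, hmL, hle⟩ := hLK n hpos
  have hm0 : (0 : ℝ) < m := by exact_mod_cast hpos.trans_le hnm
  have h₁ : Real.log (perSepCard f m ε α) < β * m := by
    have := hn₀ m (hn.trans hnm)
    rwa [div_lt_iff₀ hm0] at this
  have h₂ : Real.log (sepCard (fun _ => g) n ε) ≤
      Real.log K + Real.log (perSepCard f m ε α) := by
    refine (log_natCast_le_log hle).trans ?_
    rcases Nat.eq_zero_or_pos (perSepCard f m ε α) with h0 | h0
    · simpa [h0] using Real.log_natCast_nonneg K
    · rw [Nat.cast_mul, Real.log_mul (by exact_mod_cast hK.ne') (by exact_mod_cast h0.ne')]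
  have h₃ : (m : ℝ) ≤ n + L := by exact_mod_cast hmL
  have h₄ : β * m ≤ β * (n + L) := by gcongr
  linarith

lemma bddAbove_limsup_sepCard_of_finite {X : Type*} [MetricSpace X] [Finite X] (f : ℕ → X → X) :
    BddAbove (Set.range fun ε : {e : ℝ // 0 < e} =>
      atTop.limsup fun n => Real.log (sepCard f n ε) / n) := by
  have := Fintype.ofFinite X
  refine ⟨0, ?_⟩
  rintro _ ⟨ε, rfl⟩
  refine limsup_log_div_le (K := Real.log (Fintype.card X)) (Eventually.of_forall fun n => ?_)
  rw [zero_mul, zero_add]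
  refine log_natCast_le_log (csSup_le ⟨0, ∅, by simp⟩ ?_)
  rintro k ⟨E, -, rfl⟩
  exact Finset.card_le_univ E

end LowerBound

/-- If a chain transitive NDS of homeomorphisms converges uniformly to the
continuous map `g`, then `H_p(F) ≤ h(g)`, where `h(g)` is the classical Bowen
topological entropy of `g` (the entropy of the constant sequence `g, g, …`). -/
theorem perPseudoEntropy_le_of_tendstoUniformly
    {X : Type*} [MetricSpace X] [CompactSpace X] (f : ℕ → X ≃ₜ X)
    (htrans : ChainTransitive (fun n => (f n : X → X)))
    (g : X → X) (hg : Continuous g)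
    (hconv : TendstoUniformly (fun n => (f n : X → X)) g atTop) :
    perPseudoEntropy (fun n => (f n : X → X)) ≤ ndsEntropy (fun _ => g) := by
  have : Nonempty {e : ℝ // 0 < e} := ⟨⟨1, one_pos⟩⟩
  by_cases hbdd : BddAbove (Set.range fun ε : {e : ℝ // 0 < e} =>
      atTop.limsup fun n => Real.log (sepCard (fun _ => g) n ε) / n)
  · refine ciSup_le fun ⟨ε, hε⟩ => (iInf_limsup_le_limsup hg hconv hε).trans ?_
    exact le_ciSup hbdd (⟨ε / 4, by positivity⟩ : {e : ℝ // 0 < e})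
  · have hinf : Infinite X := by
      by_contra hfin
      rw [not_infinite_iff_finite] at hfin
      exact hbdd (bddAbove_limsup_sepCard_of_finite _)
    have hunb : ¬ BddAbove (Set.range fun ε : {e : ℝ // 0 < e} =>
        ⨅ α : {a : ℝ // 0 < a}, atTop.limsup fun n : ℕ =>
          Real.log (perSepCard (fun n => (f n : X → X)) n ε α) / n) := by
      rintro ⟨B, hB⟩
      refine hbdd ⟨B, ?_⟩
      rintro _ ⟨ε, rfl⟩
      exact (limsup_le_iInf_limsup hconv (fun α hα x y => htrans.limit hconv hα x y) ε.2).trans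
        (hB ⟨ε, rfl⟩)
    rw [perPseudoEntropy, ndsEntropy, Real.iSup_of_not_bddAbove hunb,
      Real.iSup_of_not_bddAbove hbdd]
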